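/- Let n be a positive multiple of 5 and let k ≥ 2. If F_1, F_2, ..., F_k are graphs on a common vertex set of size n, each of which is the vertex-disjoint union of n/5 copies of the 5-cycle C_5, then: (i) for k = 2, the simultaneous domination number of F_1, F_2 is at most 3n/5, and there is a choice of such F_1, F_2 attaining γ_sd(F_1,F_2) = 3n/5; and (ii) for k ≥ 3, the simultaneous domination number of F_1, ..., F_k is at most (3/5 + (2/5)(1 − (3/5)^{k−2})) · n. -/

import Mathlib

/-- The simultaneous domination number of factors `F 0, …, F (k-1)` on a common
finite vertex set: the minimum cardinality of a set `S` that is a dominating set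
in every factor. -/
noncomputable def simDomNum {V : Type*} [Fintype V] {k : ℕ}
    (F : Fin k → SimpleGraph V) : ℕ :=
  sInf {m | ∃ S : Finset V, (∀ i, ∀ v ∉ S, ∃ u ∈ S, (F i).Adj v u) ∧ S.card = m}

/-- `G` is the vertex-disjoint union of copies of the graph `H`: the vertex set
partitions into blocks, the induced subgraph on each block is isomorphic to `H`,
and there are no edges between blocks. -/
def IsDisjointUnionCopies {V W : Type*} [Fintype V] [DecidableEq V]
    (G : SimpleGraph V) (H : SimpleGraph W) : Prop :=
  ∃ P : Finpartition (Finset.univ : Finset V),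
    (∀ b ∈ P.parts, Nonempty (G.induce (↑b : Set V) ≃g H)) ∧
    ∀ u v : V, G.Adj u v → ∃ b ∈ P.parts, u ∈ b ∧ v ∈ b

theorem coords19 {V : Type*} [Fintype V] [DecidableEq V] {m : ℕ} (hn : Fintype.card V = 5 * m)
    (G : SimpleGraph V) (h : IsDisjointUnionCopies G (SimpleGraph.cycleGraph 5)) :
    ∃ e : V ≃ Fin m × Fin 5, ∀ i a b, (SimpleGraph.cycleGraph 5).Adj a b →
      G.Adj (e.symm (i, a)) (e.symm (i, b)) := by
  obtain ⟨P, hP, -⟩ := h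
  let φ : ∀ b : P.parts, G.induce (↑b.1 : Set V) ≃g SimpleGraph.cycleGraph 5 :=
    fun b => (hP b.1 b.2).some
  let f : P.parts × Fin 5 → V := fun p => ((φ p.1).symm p.2).1
  have hf : Function.Bijective f := by
    constructor
    · rintro ⟨b, x⟩ ⟨c, y⟩ hxy
      have h1 : f (b, x) ∈ b.1 := ((φ b).symm x).2
      have h2 : f (c, y) ∈ c.1 := ((φ c).symm y).2
      rw [hxy] at h1
      have hbc : b = c := Subtype.ext (P.eq_of_mem_parts b.2 c.2 h1 h2)
      subst hbc
      have : x = y := (φ b).symm.injective (Subtype.ext hxy)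
      rw [this]
    · intro v
      obtain ⟨b, hb, hv⟩ := P.exists_mem (Finset.mem_univ v)
      refine ⟨(⟨b, hb⟩, φ ⟨b, hb⟩ ⟨v, hv⟩), ?_⟩
      simp [f]
  let e0 := Equiv.ofBijective f hf
  have hc : Fintype.card P.parts = m := by
    have := Fintype.card_congr e0
    simp only [Fintype.card_prod, Fintype.card_fin] at this
    omega
  let g := Fintype.equivFinOfCardEq hc
  refine ⟨e0.symm.trans (g.prodCongr (Equiv.refl _)), ?_⟩
  intro i a b hab
  have := (φ (g.symm i)).symm.map_adj_iff.2 hab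
  simpa [e0, f] using this

theorem dom19 {V : Type*} [Fintype V] [DecidableEq V] {m : ℕ}
    (G : SimpleGraph V) (e : V ≃ Fin m × Fin 5)
    (he : ∀ i a b, (SimpleGraph.cycleGraph 5).Adj a b →
      G.Adj (e.symm (i, a)) (e.symm (i, b))) (S : Finset V)
    (hS : ∀ i, ∃ a, e.symm (i, a) ∈ S ∧ e.symm (i, a + 2) ∈ S) :
    ∀ v ∉ S, ∃ u ∈ S, G.Adj v u := by
  intro v hv
  obtain ⟨⟨i, x⟩, rfl⟩ := e.symm.surjective v
  obtain ⟨a, h1, h2⟩ := hS i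
  have key : ∀ a x : Fin 5, x = a ∨ x = a + 2 ∨ (SimpleGraph.cycleGraph 5).Adj x a ∨
      (SimpleGraph.cycleGraph 5).Adj x (a + 2) := by
    decide
  rcases key a x with h | h | h | h
  · subst h; exact absurd h1 hv
  · subst h; exact absurd h2 hv
  · exact ⟨_, h1, he _ _ _ h⟩
  · exact ⟨_, h2, he _ _ _ h⟩

theorem card19 {V : Type*} [Fintype V] [DecidableEq V] {m : ℕ} (e : V ≃ Fin m × Fin 5)
    (T : Finset V) :
    T.card = ∑ i, (Finset.univ.filter fun a => e.symm (i, a) ∈ T).card := by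
  rw [Finset.card_eq_sum_card_fiberwise (f := fun v => (e v).1) (t := Finset.univ)
    (fun _ _ => by simp)]
  refine Finset.sum_congr rfl fun i _ => ?_
  refine Finset.card_bij' (fun v _ => (e v).2) (fun a _ => e.symm (i, a)) ?_ ?_ ?_ ?_
  · intro v hv
    simp only [Finset.mem_filter] at hv
    obtain ⟨h1, rfl⟩ := hv
    simpa using h1
  · intro a ha
    simpa using ha
  · intro v hv
    simp only [Finset.mem_filter] at hv
    obtain ⟨h1, rfl⟩ := hv
    simp
  · intro a ha
    simp

theorem step19 {V : Type*} [Fintype V] [DecidableEq V] {m : ℕ}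
    (e : V ≃ Fin m × Fin 5) (T : Finset V) :
    ∃ T' ⊆ T, 3 * T.card ≤ 5 * T'.card ∧
      ∀ i, ∃ a, e.symm (i, a) ∉ T' ∧ e.symm (i, a + 2) ∉ T' := by
  have key : ∀ A : Finset (Fin 5), ∃ a : Fin 5,
      3 * A.card ≤ 5 * (A.filter fun b => b ≠ a ∧ b ≠ a + 2).card := by decide
  choose a ha using fun i : Fin m => key (Finset.univ.filter fun a => e.symm (i, a) ∈ T)
  refine ⟨T.filter fun v => (e v).2 ≠ a (e v).1 ∧ (e v).2 ≠ a (e v).1 + 2,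
    Finset.filter_subset _ _, ?_, ?_⟩
  · rw [card19 e T, card19 e (Finset.filter _ _), Finset.mul_sum, Finset.mul_sum]
    refine Finset.sum_le_sum fun i _ => (ha i).trans ?_
    rw [Finset.filter_filter]
    simp
  · intro i
    exact ⟨a i, by simp, by simp⟩

theorem hall19 {V : Type*} [Fintype V] [DecidableEq V] {m r : ℕ} (f g : V → Fin m)
    (U : Finset V) (hf : ∀ i, (U.filter fun v => f v = i).card = r + 1)
    (hg : ∀ i, (U.filter fun v => g v = i).card = r + 1) :
    ∃ M ⊆ U, (∀ i, (M.filter fun v => f v = i).card = 1) ∧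
      (∀ i, (M.filter fun v => g v = i).card = 1) := by
  have gen : ∀ (h : V → Fin m), (∀ i, (U.filter fun v => h v = i).card = r + 1) →
      ∀ A : Finset (Fin m), (U.filter fun v => h v ∈ A).card = (r + 1) * A.card := by
    intro h hh A
    rw [Finset.card_eq_sum_card_fiberwise (f := h) (t := A) (fun v hv => by simp at hv; exact hv.2)]
    rw [Finset.sum_congr rfl (g := fun _ => r + 1)]
    · simp [mul_comm]
    · intro i hi
      rw [← hh i, Finset.filter_filter]
      congr 1
      ext v
      simp only [Finset.mem_filter]
      constructor
      · rintro ⟨h1, h2, h3⟩; exact ⟨h1, h3⟩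
      · rintro ⟨h1, h3⟩; exact ⟨h1, h3 ▸ hi, h3⟩
  have hall := (Finset.all_card_le_biUnion_card_iff_exists_injective
    (fun i => (U.filter fun v => f v = i).image g)).1 (by
      intro A
      have h1 := gen f hf A
      have h2 := gen g hg (A.biUnion fun i => (U.filter fun v => f v = i).image g)
      have h3 : (U.filter fun v => f v ∈ A) ⊆
          (U.filter fun v => g v ∈ A.biUnion fun i => (U.filter fun v => f v = i).image g) := by
        intro v hv
        simp only [Finset.mem_filter, Finset.mem_biUnion, Finset.mem_image] at hv ⊢
        exact ⟨hv.1, f v, hv.2, v, ⟨hv.1, rfl⟩, rfl⟩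
      have h4 := Finset.card_le_card h3
      rw [h1, h2] at h4
      exact Nat.le_of_mul_le_mul_left h4 (Nat.succ_pos r))
  obtain ⟨φ, hφ, hm⟩ := hall
  simp only [Finset.mem_image, Finset.mem_filter] at hm
  choose w hw hw2 using hm
  have hsurj := Finite.surjective_of_injective hφ
  refine ⟨Finset.univ.image w, ?_, ?_, ?_⟩
  · intro v hv
    simp only [Finset.mem_image, Finset.mem_univ, true_and] at hv
    obtain ⟨i, rfl⟩ := hv
    exact (hw i).1
  · intro i
    rw [Finset.card_eq_one]
    refine ⟨w i, ?_⟩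
    ext v
    simp only [Finset.mem_filter, Finset.mem_image, Finset.mem_univ, true_and,
      Finset.mem_singleton]
    constructor
    · rintro ⟨⟨j, rfl⟩, h⟩
      rw [(hw j).2] at h
      rw [h]
    · rintro rfl
      exact ⟨⟨i, rfl⟩, (hw i).2⟩
  · intro i
    obtain ⟨j, rfl⟩ := hsurj i
    rw [Finset.card_eq_one]
    refine ⟨w j, ?_⟩
    ext v
    simp only [Finset.mem_filter, Finset.mem_image, Finset.mem_univ, true_and,
      Finset.mem_singleton]
    constructor
    · rintro ⟨⟨l, rfl⟩, h⟩
      rw [hw2 l] at h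
      rw [hφ h]
    · rintro rfl
      exact ⟨⟨j, rfl⟩, hw2 j⟩

theorem fib19 {V : Type*} [Fintype V] [DecidableEq V] {m : ℕ} (e : V ≃ Fin m × Fin 5)
    (T : Finset V) (i : Fin m) :
    (T.filter fun v => (e v).1 = i).card =
      (Finset.univ.filter fun a => e.symm (i, a) ∈ T).card := by
  refine Finset.card_bij' (fun v _ => (e v).2) (fun a _ => e.symm (i, a)) ?_ ?_ ?_ ?_
  · intro v hv
    simp only [Finset.mem_filter] at hv
    obtain ⟨h1, rfl⟩ := hv
    simpa using h1
  · intro a ha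
    simpa using ha
  · intro v hv
    simp only [Finset.mem_filter] at hv
    obtain ⟨h1, rfl⟩ := hv
    simp
  · intro a ha
    simp

theorem two19 {V : Type*} [Fintype V] [DecidableEq V] {m : ℕ} (e e' : V ≃ Fin m × Fin 5) :
    ∃ T : Finset V, T.card = 2 * m ∧
      (∀ i, ∃ a, e.symm (i, a) ∉ T ∧ e.symm (i, a + 2) ∉ T) ∧
      (∀ i, ∃ a, e'.symm (i, a) ∉ T ∧ e'.symm (i, a + 2) ∉ T) := by
  have h5 : ∀ (e : V ≃ Fin m × Fin 5) i,
      ((Finset.univ : Finset V).filter fun v => (e v).1 = i).card = 4 + 1 := by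
    intro e i
    rw [fib19]; simp
  obtain ⟨M, -, h1, h2⟩ := hall19 (fun v => (e v).1) (fun v => (e' v).1) Finset.univ
    (h5 e) (h5 e')
  have h4 : ∀ (e : V ≃ Fin m × Fin 5), (∀ i, (M.filter fun v => (e v).1 = i).card = 1) →
      ∀ i, ((Finset.univ \ M).filter fun v => (e v).1 = i).card = 3 + 1 := by
    intro e he i
    have h := h5 e i
    have h' : (Finset.univ : Finset V) = (Finset.univ \ M) ∪ M := by simp
    rw [h', Finset.filter_union, Finset.card_union_of_disjoint
      (Finset.disjoint_filter_filter Finset.sdiff_disjoint), he] at h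
    omega
  obtain ⟨N, hN, h3, h6⟩ := hall19 (fun v => (e v).1) (fun v => (e' v).1) (Finset.univ \ M)
    (h4 e h1) (h4 e' h2)
  have hd : Disjoint M N := by
    rw [Finset.disjoint_left]
    intro v hv hv'
    have := hN hv'
    simp at this
    exact this hv
  have key : ∀ A : Finset (Fin 5), A.card = 2 → ∃ a : Fin 5, a ∉ A ∧ a + 2 ∉ A := by decide
  have fin : ∀ (e : V ≃ Fin m × Fin 5), (∀ i, (M.filter fun v => (e v).1 = i).card = 1) →
      (∀ i, (N.filter fun v => (e v).1 = i).card = 1) → ∀ i,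
      (Finset.univ.filter fun a => e.symm (i, a) ∈ M ∪ N).card = 2 := by
    intro e ha hb i
    rw [← fib19, Finset.filter_union, Finset.card_union_of_disjoint, ha, hb]
    exact Finset.disjoint_filter_filter hd
  have fin2 : ∀ (e : V ≃ Fin m × Fin 5), (∀ i, (M.filter fun v => (e v).1 = i).card = 1) →
      (∀ i, (N.filter fun v => (e v).1 = i).card = 1) → ∀ i,
      ∃ a, e.symm (i, a) ∉ M ∪ N ∧ e.symm (i, a + 2) ∉ M ∪ N := by
    intro e ha hb i
    obtain ⟨a, h, h'⟩ := key _ (fin e ha hb i)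
    simp only [Finset.mem_filter, Finset.mem_univ, true_and] at h h'
    exact ⟨a, h, h'⟩
  refine ⟨M ∪ N, ?_, fin2 e h1 h3, fin2 e' h2 h6⟩
  rw [card19 e, Finset.sum_congr rfl fun i _ => fin e h1 h3 i]
  simp [mul_comm]

theorem many19 {V : Type*} [Fintype V] [DecidableEq V] {m : ℕ} (j : ℕ) :
    ∀ (e : Fin (j + 2) → V ≃ Fin m × Fin 5),
    ∃ T : Finset V, 3 ^ j * (2 * m) ≤ 5 ^ j * T.card ∧
      ∀ l i, ∃ a, (e l).symm (i, a) ∉ T ∧ (e l).symm (i, a + 2) ∉ T := by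
  induction j with
  | zero =>
    intro e
    obtain ⟨T, h, h0, h1⟩ := two19 (e 0) (e 1)
    refine ⟨T, by simp [h], ?_⟩
    intro l
    fin_cases l
    · exact h0
    · exact h1
  | succ j ih =>
    intro e
    obtain ⟨T, h, h0⟩ := ih (fun l => e l.castSucc)
    obtain ⟨T', hs, hc, h1⟩ := step19 (e (Fin.last _)) T
    refine ⟨T', ?_, ?_⟩
    · rw [pow_succ, pow_succ]
      have := Nat.mul_le_mul_left (5 ^ j) hc
      nlinarith
    · intro l
      refine Fin.lastCases h1 (fun l => ?_) l
      intro i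
      obtain ⟨a, ha, hb⟩ := h0 l i
      exact ⟨a, fun h => ha (hs h), fun h => hb (hs h)⟩

theorem upper19 {V : Type*} [Fintype V] [DecidableEq V] {m j : ℕ}
    (hn : Fintype.card V = 5 * m) (F : Fin (j + 2) → SimpleGraph V)
    (hF : ∀ i, IsDisjointUnionCopies (F i) (SimpleGraph.cycleGraph 5)) :
    ∃ t : ℕ, 3 ^ j * (2 * m) ≤ 5 ^ j * t ∧ simDomNum F + t ≤ 5 * m := by
  choose e he using fun i => coords19 hn (F i) (hF i)
  obtain ⟨T, h1, h2⟩ := many19 j e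
  refine ⟨T.card, h1, ?_⟩
  have : simDomNum F ≤ Tᶜ.card := by
    refine Nat.sInf_le ⟨Tᶜ, fun i => ?_, rfl⟩
    exact dom19 (F i) (e i) (he i) _ (by simpa using h2 i)
  have h3 := Finset.card_compl_add_card T
  omega

def blockGraph19 {V : Type*} {m : ℕ} (e : V ≃ Fin m × Fin 5) (σ : Fin 5 ≃ Fin 5) :
    SimpleGraph V where
  Adj v w := (e v).1 = (e w).1 ∧ (SimpleGraph.cycleGraph 5).Adj (σ (e v).2) (σ (e w).2)
  symm := ⟨fun _ _ h => ⟨h.1.symm, h.2.symm⟩⟩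
  loopless := ⟨fun _ h => h.2.ne rfl⟩

theorem block19 {V : Type*} [Fintype V] [DecidableEq V] {m : ℕ} (e : V ≃ Fin m × Fin 5)
    (σ : Fin 5 ≃ Fin 5) :
    IsDisjointUnionCopies (blockGraph19 e σ) (SimpleGraph.cycleGraph 5) := by
  classical
  refine ⟨Finpartition.ofSetoid (Setoid.ker fun v => (e v).1), ?_, ?_⟩
  · intro b hb
    obtain ⟨v0, -, hv0⟩ := Finset.mem_image.1 hb
    have hmem : ∀ v, v ∈ b ↔ (e v).1 = (e v0).1 := by
      intro v
      rw [← hv0]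
      simp [Setoid.ker, Function.onFun, eq_comm]
    refine ⟨⟨⟨fun v => σ (e v.1).2, fun a => ⟨e.symm ((e v0).1, σ.symm a), by
      simp [hmem]⟩, ?_, ?_⟩, ?_⟩⟩
    · rintro ⟨v, hv⟩
      have := (hmem v).1 hv
      simp [← this]
    · intro a
      simp
    · rintro ⟨v, hv⟩ ⟨w, hw⟩
      have h1 := (hmem v).1 hv
      have h2 := (hmem w).1 hw
      simp [blockGraph19, h1, h2]
  · intro u v h
    refine ⟨_, (Finpartition.ofSetoid (Setoid.ker fun v => (e v).1)).part_mem.2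
      (Finset.mem_univ u), Finpartition.mem_part _ (Finset.mem_univ u), ?_⟩
    rw [Finpartition.mem_part_ofSetoid_iff_rel]
    exact h.1

theorem lower19 {V : Type*} [Fintype V] [DecidableEq V] {m : ℕ} (e : V ≃ Fin m × Fin 5)
    (σ : Fin 5 ≃ Fin 5) (hσ : ∀ x, σ x = 2 * x) :
    3 * m ≤ simDomNum ![blockGraph19 e (Equiv.refl _), blockGraph19 e σ] := by
  have key : ∀ A : Finset (Fin 5),
    (∀ v ∉ A, ∃ u ∈ A, (SimpleGraph.cycleGraph 5).Adj v u) →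
    (∀ v ∉ A, ∃ u ∈ A, (SimpleGraph.cycleGraph 5).Adj (2 * v) (2 * u)) → 3 ≤ A.card := by
    decide
  refine le_csInf ⟨_, Finset.univ, by simp, rfl⟩ ?_
  rintro _ ⟨S, hS, rfl⟩
  rw [card19 e S]
  have : ∀ i ∈ (Finset.univ : Finset (Fin m)),
      3 ≤ (Finset.univ.filter fun a => e.symm (i, a) ∈ S).card := by
    intro i _
    apply key
    · intro v hv
      obtain ⟨u, hu, h1, h2⟩ := hS 0 (e.symm (i, v)) (by simpa using hv)
      obtain ⟨⟨j, u⟩, rfl⟩ := e.symm.surjective u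
      simp at h1 h2
      subst h1
      exact ⟨u, by simpa using hu, h2⟩
    · intro v hv
      obtain ⟨u, hu, h1, h2⟩ := hS 1 (e.symm (i, v)) (by simpa using hv)
      obtain ⟨⟨j, u⟩, rfl⟩ := e.symm.surjective u
      simp [hσ] at h1 h2
      subst h1
      exact ⟨u, by simpa using hu, h2⟩
  have := Finset.sum_le_sum this
  simpa [mul_comm] using this

theorem stmt19 {V : Type*} [Fintype V] [DecidableEq V] {n k : ℕ} (hn0 : 0 < n)
    (hdvd : 5 ∣ n) (hn : Fintype.card V = n) (hk : 2 ≤ k) :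
    (∀ F : Fin k → SimpleGraph V,
      (∀ i, IsDisjointUnionCopies (F i) (SimpleGraph.cycleGraph 5)) →
        (k = 2 → simDomNum F ≤ 3 * n / 5) ∧
        (3 ≤ k → (simDomNum F : ℝ) ≤
          (3 / 5 + (2 / 5) * (1 - ((3 : ℝ) / 5) ^ (k - 2))) * n)) ∧
    (∃ F₁ F₂ : SimpleGraph V,
      IsDisjointUnionCopies F₁ (SimpleGraph.cycleGraph 5) ∧
      IsDisjointUnionCopies F₂ (SimpleGraph.cycleGraph 5) ∧
      simDomNum ![F₁, F₂] = 3 * n / 5) := by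
  obtain ⟨m, rfl⟩ := hdvd
  constructor
  · intro F hF
    obtain ⟨j, rfl⟩ := Nat.exists_eq_add_of_le' hk
    obtain ⟨t, h1, h2⟩ := upper19 hn F hF
    constructor
    · intro hj
      obtain rfl : j = 0 := by omega
      simp at h1
      omega
    · intro _
      have h1' : (3 : ℝ) ^ j * (2 * m) ≤ 5 ^ j * t := by exact_mod_cast h1
      have h2' : (simDomNum F : ℝ) + t ≤ 5 * m := by exact_mod_cast h2
      have h3 : ((3 : ℝ) / 5) ^ j * (2 * m) ≤ t := by
        rw [div_pow, div_mul_eq_mul_div, div_le_iff₀ (by positivity)]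
        linarith
      rw [Nat.add_sub_cancel]
      push_cast
      linarith
  · let e : V ≃ Fin m × Fin 5 := Fintype.equivOfCardEq (by simp [hn, mul_comm])
    let σ : Fin 5 ≃ Fin 5 := ⟨fun x => 2 * x, fun x => 3 * x, by decide, by decide⟩
    have b1 := block19 e (Equiv.refl _)
    have b2 := block19 e σ
    refine ⟨_, _, b1, b2, le_antisymm ?_ ?_⟩
    · obtain ⟨t, h1, h2⟩ := upper19 (j := 0) hn
        ![blockGraph19 e (Equiv.refl _), blockGraph19 e σ] (by
          intro i
          fin_cases i
          · exact b1
          · exact b2)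
      simp at h1
      omega
    · have := lower19 e σ (fun _ => rfl)
      omega
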